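/- Let ν > −1. The function q_ν : [0, α_{ν,1}²) → (0,∞) defined by q_ν(x) = x^{ν/2} e^{−3x/(4(ν+1))} / d_ν(√x) is absolutely monotonic on [0, α_{ν,1}²), i.e., q_ν^{(m)}(x) ≥ 0 for all integers m ≥ 0 and all x ∈ [0, α_{ν,1}²). -/

import Mathlib

open Real Filter Set

/-- The Bessel function of the first kind of order `ν`, defined by its power series. -/
noncomputable def besselJ (ν x : ℝ) : ℝ :=
  ∑' n : ℕ, (-1 : ℝ) ^ n * x ^ (2 * (n : ℝ) + ν) /
    (2 ^ (2 * (n : ℝ) + ν) * (n.factorial : ℝ) * Real.Gamma ((n : ℝ) + ν + 1))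

/-- The Dini function `d_ν(x) = (1-ν) J_ν(x) + x J_ν'(x) = J_ν(x) - x J_{ν+1}(x)`. -/
noncomputable def dini (ν x : ℝ) : ℝ :=
  besselJ ν x - x * besselJ (ν + 1) x

open scoped ContDiff Topology

/-- The derivatives of `f` of order at most `N` are nonnegative on `[0, b)`. -/
def NonnegDerivsUpTo (b : ℝ) (N : ℕ) (f : ℝ → ℝ) : Prop :=
  ∀ m ≤ N, ∀ x ∈ Ico (0 : ℝ) b, 0 ≤ iteratedDeriv m f x

/-- `f` is smooth at every point of `[0, b)`. -/
def SmoothOnIco (b : ℝ) (f : ℝ → ℝ) : Prop :=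
  ∀ x ∈ Ico (0 : ℝ) b, ContDiffAt ℝ ∞ f x

namespace SmoothOnIco

variable {b : ℝ} {f g : ℝ → ℝ}

lemma of_le (hf : SmoothOnIco b f) {x : ℝ} (hx : x ∈ Ico (0 : ℝ) b) (n : ℕ) :
    ContDiffAt ℝ n f x :=
  (hf x hx).of_le (by exact_mod_cast le_top)

lemma deriv (hf : SmoothOnIco b f) : SmoothOnIco b (deriv f) :=
  fun x hx ↦ (hf x hx).derivWithin (by simp)

lemma iteratedDeriv (hf : SmoothOnIco b f) (n : ℕ) : SmoothOnIco b (iteratedDeriv n f) := by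
  induction n with
  | zero => simpa using hf
  | succ n ih => rw [iteratedDeriv_succ]; exact ih.deriv

lemma differentiableAt (hf : SmoothOnIco b f) {x : ℝ} (hx : x ∈ Ico (0 : ℝ) b) :
    DifferentiableAt ℝ f x :=
  (hf x hx).differentiableAt (by simp)

lemma continuousOn (hf : SmoothOnIco b f) : ContinuousOn f (Ico 0 b) :=
  fun _ hx ↦ (hf.differentiableAt hx).continuousAt.continuousWithinAt

lemma mul (hf : SmoothOnIco b f) (hg : SmoothOnIco b g) : SmoothOnIco b (fun x ↦ f x * g x) :=
  fun x hx ↦ (hf x hx).mul (hg x hx)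

lemma add (hf : SmoothOnIco b f) (hg : SmoothOnIco b g) : SmoothOnIco b (fun x ↦ f x + g x) :=
  fun x hx ↦ (hf x hx).add (hg x hx)

lemma sub (hf : SmoothOnIco b f) (hg : SmoothOnIco b g) : SmoothOnIco b (fun x ↦ f x - g x) :=
  fun x hx ↦ (hf x hx).sub (hg x hx)

lemma div (hf : SmoothOnIco b f) (hg : SmoothOnIco b g) (h : ∀ x ∈ Ico (0 : ℝ) b, g x ≠ 0) :
    SmoothOnIco b (fun x ↦ f x / g x) :=
  fun x hx ↦ (hf x hx).div (hg x hx) (h x hx)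

end SmoothOnIco

lemma ContDiff.smoothOnIco {f : ℝ → ℝ} (hf : ContDiff ℝ ∞ f) (b : ℝ) : SmoothOnIco b f :=
  fun _ _ ↦ hf.contDiffAt

namespace NonnegDerivsUpTo

variable {b : ℝ} {N : ℕ} {f g : ℝ → ℝ}

lemma mono (hf : NonnegDerivsUpTo b N f) {M : ℕ} (h : M ≤ N) : NonnegDerivsUpTo b M f :=
  fun m hm ↦ hf m (hm.trans h)

lemma congr (hf : NonnegDerivsUpTo b N f) (h : ∀ x ∈ Ico (0 : ℝ) b, g =ᶠ[𝓝 x] f) :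
    NonnegDerivsUpTo b N g := fun m hm x hx ↦ by
  rw [(h x hx).iteratedDeriv_eq m]; exact hf m hm x hx

lemma add (hf : NonnegDerivsUpTo b N f) (hg : NonnegDerivsUpTo b N g)
    (sf : SmoothOnIco b f) (sg : SmoothOnIco b g) :
    NonnegDerivsUpTo b N (fun x ↦ f x + g x) := fun m hm x hx ↦ by
  rw [iteratedDeriv_fun_add (sf.of_le hx m) (sg.of_le hx m)]
  exact add_nonneg (hf m hm x hx) (hg m hm x hx)

lemma mul (hf : NonnegDerivsUpTo b N f) (hg : NonnegDerivsUpTo b N g)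
    (sf : SmoothOnIco b f) (sg : SmoothOnIco b g) :
    NonnegDerivsUpTo b N (fun x ↦ f x * g x) := fun m hm x hx ↦ by
  rw [iteratedDeriv_fun_mul (sf.of_le hx m) (sg.of_le hx m)]
  refine Finset.sum_nonneg fun i hi ↦ ?_
  have hi' : i ≤ m := Nat.lt_succ_iff.mp (Finset.mem_range.mp hi)
  exact mul_nonneg (mul_nonneg (Nat.cast_nonneg _) (hf i (hi'.trans hm) x hx))
    (hg (m - i) ((Nat.sub_le _ _).trans hm) x hx)

lemma deriv (hf : NonnegDerivsUpTo b (N + 1) f) : NonnegDerivsUpTo b N (deriv f) :=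
  fun m hm x hx ↦ by
    rw [← iteratedDeriv_succ']; exact hf (m + 1) (by omega) x hx

lemma of_deriv (h0 : ∀ x ∈ Ico (0 : ℝ) b, 0 ≤ f x) (hf : NonnegDerivsUpTo b N (_root_.deriv f)) :
    NonnegDerivsUpTo b (N + 1) f := by
  intro m hm x hx
  cases m with
  | zero => simpa using h0 x hx
  | succ m => rw [iteratedDeriv_succ']; exact hf m (by omega) x hx

lemma zero_iff : NonnegDerivsUpTo b 0 f ↔ ∀ x ∈ Ico (0 : ℝ) b, 0 ≤ f x := by
  simp [NonnegDerivsUpTo]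

end NonnegDerivsUpTo

lemma iteratedDeriv_succ_fun_id (n : ℕ) :
    iteratedDeriv (n + 1) (fun x : ℝ ↦ x) = fun _ ↦ if n = 0 then 1 else 0 := by
  ext x
  rw [iteratedDeriv_succ', deriv_id'', iteratedDeriv_const]

lemma nonnegDerivsUpTo_id (b : ℝ) (N : ℕ) : NonnegDerivsUpTo b N (fun x ↦ x) := by
  intro m _ x hx
  cases m with
  | zero => simpa using hx.1
  | succ m => rw [iteratedDeriv_succ_fun_id]; positivity

lemma nonnegDerivsUpTo_const (b : ℝ) (N : ℕ) {c : ℝ} (hc : 0 ≤ c) :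
    NonnegDerivsUpTo b N (fun _ ↦ c) := by
  intro m _ x _
  rw [iteratedDeriv_const]
  split_ifs <;> simp [hc]

lemma iteratedDeriv_succ_id_mul {f : ℝ → ℝ} {x : ℝ} {n : ℕ}
    (hf : ContDiffAt ℝ (n + 1 : ℕ) f x) :
    iteratedDeriv (n + 1) (fun y ↦ y * f y) x =
      x * iteratedDeriv (n + 1) f x + (n + 1) * iteratedDeriv n f x := by
  rw [iteratedDeriv_fun_mul (f := fun y ↦ y) contDiffAt_id hf, Finset.sum_range_succ',
    Finset.sum_range_succ',
    Finset.sum_eq_zero]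
  · simp [add_comm]
  · intro i _
    rw [iteratedDeriv_succ_fun_id]; simp

/-- A solution of `x y' + (p - x g) y ≥ 0`, `p > 0`, which is continuous at `0` is nonnegative:
use the integrating factor `x ^ p K` with `K' = -g K`. -/
lemma nonneg_of_integratingFactor {b p : ℝ} (hp : 0 < p) {y y' g K : ℝ → ℝ}
    (hyc : ContinuousOn y (Ico 0 b)) (hKc : ContinuousOn K (Ico 0 b))
    (hy : ∀ x ∈ Ioo 0 b, HasDerivAt y (y' x) x)
    (hK : ∀ x ∈ Ioo 0 b, HasDerivAt K (-g x * K x) x)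
    (hKpos : ∀ x ∈ Ioo 0 b, 0 < K x)
    (h : ∀ x ∈ Ioo 0 b, 0 ≤ x * y' x + (p - x * g x) * y x) :
    ∀ x ∈ Ioo 0 b, 0 ≤ y x := by
  have hd : ∀ x ∈ Ioo 0 b, HasDerivAt (fun x ↦ x ^ p * (K x * y x))
      (x ^ (p - 1) * K x * (x * y' x + (p - x * g x) * y x)) x := by
    intro x hx
    convert! (Real.hasDerivAt_rpow_const (p := p) (Or.inl hx.1.ne')).mul ((hK x hx).mul (hy x hx))
      using 1
    have : x ^ p = x ^ (p - 1) * x := by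
      rw [← Real.rpow_add_one hx.1.ne']; ring_nf
    rw [this]
    simp only [Pi.mul_apply]
    ring
  have hmono : MonotoneOn (fun x ↦ x ^ p * (K x * y x)) (Ico 0 b) := by
    apply monotoneOn_of_deriv_nonneg (convex_Ico 0 b)
    · exact (continuousOn_id.rpow_const fun x _ ↦ Or.inr hp.le).mul (hKc.mul hyc)
    · rw [interior_Ico]
      exact fun x hx ↦ (hd x hx).differentiableAt.differentiableWithinAt
    · rw [interior_Ico]
      intro x hx
      rw [(hd x hx).deriv]
      exact mul_nonneg (mul_nonneg (Real.rpow_nonneg hx.1.le _) (hKpos x hx).le) (h x hx)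
  intro x hx
  have h0 := hmono ⟨le_rfl, hx.1.trans hx.2⟩ (Ioo_subset_Ico_self hx) hx.1.le
  simp only [Real.zero_rpow hp.ne', zero_mul] at h0
  have h1 := nonneg_of_mul_nonneg_right h0 (Real.rpow_pos_of_pos hx.1 p)
  exact nonneg_of_mul_nonneg_right h1 (hKpos x hx)

/-- Solutions of the Riccati equation `x u' + c u = r + x u²` with `c > 0` and `r ≥ 0` which are
smooth at the origin are absolutely monotonic. -/
lemma nonnegDerivsUpTo_of_riccati {b c r : ℝ} (hc : 0 < c) (hr : 0 ≤ r) {u J : ℝ → ℝ}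
    (su : SmoothOnIco b u) (hJc : ContinuousOn J (Ico 0 b))
    (hJ : ∀ x ∈ Ioo 0 b, HasDerivAt J (-u x * J x) x)
    (hJpos : ∀ x ∈ Ioo 0 b, 0 < J x)
    (hu : ∀ x ∈ Ico 0 b, ∀ᶠ y in 𝓝 x, y * deriv u y + c * u y = r + y * (u y * u y)) (N : ℕ) :
    NonnegDerivsUpTo b N u := by
  induction N with
  | zero =>
    rw [NonnegDerivsUpTo.zero_iff]
    have hpos := nonneg_of_integratingFactor hc su.continuousOn hJc
      (fun x hx ↦ (su.differentiableAt (Ioo_subset_Ico_self hx)).hasDerivAt) hJ hJpos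
      (fun x hx ↦ by
        have := (hu x (Ioo_subset_Ico_self hx)).self_of_nhds
        nlinarith)
    intro x hx
    rcases hx.1.eq_or_lt with rfl | h0
    · have := (hu 0 hx).self_of_nhds
      simp only [zero_mul, zero_add, add_zero] at this
      exact nonneg_of_mul_nonneg_right (this ▸ hr) hc
    · exact hpos x ⟨h0, hx.2⟩
  | succ N ih =>
    have suu := su.mul su
    have key : ∀ x ∈ Ico 0 b, x * iteratedDeriv (N + 2) u x
        + (N + 1 + c) * iteratedDeriv (N + 1) u x
        = x * iteratedDeriv (N + 1) (fun y ↦ u y * u y) x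
          + (N + 1) * iteratedDeriv N (fun y ↦ u y * u y) x := by
      intro x hx
      have h := Filter.EventuallyEq.iteratedDeriv_eq (N + 1) (hu x hx)
      have sx : SmoothOnIco b (fun y ↦ y) := contDiff_id.smoothOnIco b
      have sc : SmoothOnIco b (fun _ ↦ c) := contDiff_const.smoothOnIco b
      rw [iteratedDeriv_fun_add ((sx.mul su.deriv).of_le hx _) ((sc.mul su).of_le hx _),
        iteratedDeriv_succ_id_mul (su.deriv.of_le hx _),
        iteratedDeriv_const_mul _ (su.of_le hx _),
        iteratedDeriv_const_add (Nat.succ_pos N),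
        iteratedDeriv_succ_id_mul (suu.of_le hx _), ← iteratedDeriv_succ',
        ← iteratedDeriv_succ'] at h
      linarith
    have hR : ∀ x ∈ Ico 0 b, 2 * u x * iteratedDeriv (N + 1) u x ≤
        iteratedDeriv (N + 1) (fun y ↦ u y * u y) x := by
      intro x hx
      rw [iteratedDeriv_fun_mul (su.of_le hx _) (su.of_le hx _), Finset.sum_range_succ,
        Finset.sum_range_succ']
      have : 0 ≤ ∑ k ∈ Finset.range N, ((N + 1).choose (k + 1) : ℝ) * iteratedDeriv (k + 1) u x *
          iteratedDeriv (N + 1 - (k + 1)) u x := by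
        refine Finset.sum_nonneg fun i hi ↦ ?_
        have hi' := Finset.mem_range.mp hi
        exact mul_nonneg (mul_nonneg (Nat.cast_nonneg _) (ih _ (by omega) x hx))
          (ih _ (by omega) x hx)
      simp only [Nat.choose_zero_right, Nat.choose_self, Nat.cast_one, one_mul, tsub_zero,
        tsub_self, iteratedDeriv_zero]
      linarith
    have hRN : ∀ x ∈ Ico 0 b, 0 ≤ (N + 1) * iteratedDeriv N (fun y ↦ u y * u y) x :=
      fun x hx ↦ mul_nonneg (by positivity) (ih.mul ih su su N le_rfl x hx)
    have hpos := nonneg_of_integratingFactor (p := N + 1 + c) (by positivity)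
      (su.iteratedDeriv (N + 1)).continuousOn (hJc.mul hJc) (g := fun x ↦ 2 * u x)
      (y' := iteratedDeriv (N + 2) u)
      (fun x hx ↦ by
        rw [iteratedDeriv_succ (n := N + 1)]
        exact ((su.iteratedDeriv (N + 1)).differentiableAt (Ioo_subset_Ico_self hx)).hasDerivAt)
      (fun x hx ↦ by
        convert! (hJ x hx).mul (hJ x hx) using 1
        simp only [Pi.mul_apply]; ring)
      (fun x hx ↦ mul_pos (hJpos x hx) (hJpos x hx))
      (fun x hx ↦ by
        have hx' := Ioo_subset_Ico_self hx
        have h1 := key x hx'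
        have h2 := mul_le_mul_of_nonneg_left (hR x hx') hx.1.le
        have h3 := hRN x hx'
        linarith)
    intro m hm x hx
    rcases hm.lt_or_eq with hm | rfl
    · exact ih m (by omega) x hx
    rcases hx.1.eq_or_lt with rfl | h0
    · have h1 := key 0 hx
      have h3 := hRN 0 hx
      simp only [zero_mul, zero_add] at h1
      exact nonneg_of_mul_nonneg_right (h1 ▸ h3) (by positivity)
    · exact hpos x ⟨h0, hx.2⟩

lemma nonnegDerivsUpTo_of_deriv_eq_mul {b : ℝ} {f L : ℝ → ℝ} (sf : SmoothOnIco b f)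
    (sL : SmoothOnIco b L) (hf : ∀ x ∈ Ico 0 b, 0 ≤ f x) (hL : ∀ N, NonnegDerivsUpTo b N L)
    (h : ∀ x ∈ Ico 0 b, deriv f =ᶠ[𝓝 x] fun y ↦ L y * f y) (N : ℕ) :
    NonnegDerivsUpTo b N f := by
  induction N with
  | zero => rwa [NonnegDerivsUpTo.zero_iff]
  | succ N ih => exact .of_deriv hf (((hL N).mul ih sL sf).congr h)

lemma nonnegDerivsUpTo_inv_one_sub {b : ℝ} {w : ℝ → ℝ} (sw : SmoothOnIco b w)
    (hw1 : ∀ x ∈ Ico 0 b, w x < 1) (hw : ∀ N, NonnegDerivsUpTo b N w) (N : ℕ) :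
    NonnegDerivsUpTo b N (fun x ↦ 1 / (1 - w x)) := by
  have sv : SmoothOnIco b (fun x ↦ 1 / (1 - w x)) :=
    .div (contDiff_const.smoothOnIco b) (.sub (contDiff_const.smoothOnIco b) sw)
      fun x hx ↦ (sub_pos.2 (hw1 x hx)).ne'
  have hv : ∀ x ∈ Ico 0 b, 0 ≤ 1 / (1 - w x) :=
    fun x hx ↦ one_div_nonneg.2 (sub_pos.2 (hw1 x hx)).le
  induction N with
  | zero => rwa [NonnegDerivsUpTo.zero_iff]
  | succ N ih =>
    refine .of_deriv hv (((hw (N + 1)).deriv.mul (ih.mul ih sv sv) sw.deriv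
      (sv.mul sv)).congr fun x hx ↦ ?_)
    have hx1 : ∀ᶠ y in 𝓝 x, w y < 1 :=
      (sw.differentiableAt hx).continuousAt.eventually_lt continuousAt_const (hw1 x hx)
    have hx2 : ∀ᶠ y in 𝓝 x, DifferentiableAt ℝ w y := by
      filter_upwards [(sw.of_le hx 1).eventually (by simp)] with y hy
      exact hy.differentiableAt (by simp)
    filter_upwards [hx1, hx2] with y hy hd
    have h1 : 1 - w y ≠ 0 := (sub_pos.2 hy).ne'
    simp only [one_div]
    rw [(hd.hasDerivAt.const_sub 1).fun_inv h1 |>.deriv]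
    field_simp

/-- The entire function `∑ (-1)ⁿ xⁿ / (4ⁿ n! Γ(n+ν+1))`, so that
`J_ν(x) = (x/2)^ν besselEntire ν (x²)`. -/
noncomputable def besselEntire (ν x : ℝ) : ℝ :=
  ∑' n : ℕ, (-x / 4) ^ n / ((n.factorial : ℝ) * Real.Gamma ((n : ℝ) + ν + 1))

namespace besselEntire

variable {ν : ℝ}

lemma gamma_pos (hν : -1 < ν) (n : ℕ) : 0 < Real.Gamma ((n : ℝ) + ν + 1) :=
  Real.Gamma_pos_of_pos (by have : (0 : ℝ) ≤ n := n.cast_nonneg; linarith)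

lemma gamma_succ (hν : -1 < ν) (n : ℕ) :
    Real.Gamma ((n : ℝ) + (ν + 1) + 1) = (n + ν + 1) * Real.Gamma ((n : ℝ) + ν + 1) := by
  have : (0 : ℝ) ≤ n := n.cast_nonneg
  rw [← Real.Gamma_add_one (by linarith)]
  ring_nf

lemma gamma_lower_bound (hν : -1 < ν) (n : ℕ) :
    (ν + 1) ^ n * Real.Gamma (ν + 1) ≤ Real.Gamma ((n : ℝ) + ν + 1) := by
  induction n with
  | zero => simp
  | succ n ih =>
    have h := gamma_succ hν n
    rw [show ((n + 1 : ℕ) : ℝ) + ν + 1 = (n : ℝ) + (ν + 1) + 1 by push_cast; ring, h, pow_succ']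
    have : (0 : ℝ) ≤ n := n.cast_nonneg
    have h2 := gamma_pos hν n
    rw [mul_assoc]
    exact mul_le_mul (by linarith) ih
      (mul_nonneg (pow_nonneg (by linarith) _) (Real.Gamma_pos_of_pos (by linarith)).le)
      (by linarith)

lemma summable_norm (hν : -1 < ν) (x : ℝ) :
    Summable fun n : ℕ ↦
      ‖(-x / 4) ^ n / ((n.factorial : ℝ) * Real.Gamma ((n : ℝ) + ν + 1))‖ := by
  have hν' : 0 < ν + 1 := by linarith
  have hG : 0 < Real.Gamma (ν + 1) := Real.Gamma_pos_of_pos hν'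
  refine Summable.of_nonneg_of_le (fun _ ↦ norm_nonneg _) (fun n ↦ ?_)
    ((Real.summable_pow_div_factorial (|x| / 4 / (ν + 1))).mul_left (1 / Real.Gamma (ν + 1)))
  have h1 := gamma_lower_bound hν n
  have h2 := gamma_pos hν n
  have h3 : (0 : ℝ) < n.factorial := by exact_mod_cast n.factorial_pos
  rw [norm_div, norm_pow, Real.norm_of_nonneg (by positivity : 0 ≤ (n.factorial : ℝ) * _),
    norm_div, norm_neg, Real.norm_eq_abs, Real.norm_of_nonneg (by norm_num : (0 : ℝ) ≤ 4)]
  calc (|x| / 4) ^ n / ((n.factorial : ℝ) * Real.Gamma ((n : ℝ) + ν + 1))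
      ≤ (|x| / 4) ^ n / ((n.factorial : ℝ) * ((ν + 1) ^ n * Real.Gamma (ν + 1))) := by gcongr
    _ = _ := by rw [div_pow (|x| / 4)]; field_simp

lemma summable (hν : -1 < ν) (x : ℝ) :
    Summable fun n : ℕ ↦ (-x / 4) ^ n / ((n.factorial : ℝ) * Real.Gamma ((n : ℝ) + ν + 1)) :=
  (summable_norm hν x).of_norm

lemma deriv_term_succ (ν x : ℝ) (n : ℕ) :
    ((n + 1 : ℕ) : ℝ) * (-x / 4) ^ n * (-1 / 4) /
      (((n + 1).factorial : ℝ) * Real.Gamma (((n + 1 : ℕ) : ℝ) + ν + 1)) =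
    -1 / 4 * ((-x / 4) ^ n / ((n.factorial : ℝ) * Real.Gamma ((n : ℝ) + (ν + 1) + 1))) := by
  rw [show ((n + 1 : ℕ) : ℝ) + ν + 1 = (n : ℝ) + (ν + 1) + 1 by push_cast; ring,
    Nat.factorial_succ]
  have h3 : (n.factorial : ℝ) ≠ 0 := by exact_mod_cast n.factorial_ne_zero
  have h4 : ((n : ℝ) + 1) ≠ 0 := by positivity
  push_cast
  rw [mul_assoc ((n : ℝ) + 1) (n.factorial : ℝ), mul_assoc ((n : ℝ) + 1),
    mul_div_mul_left _ _ h4]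
  ring

lemma hasDerivAt (hν : -1 < ν) (x : ℝ) :
    HasDerivAt (besselEntire ν) (-1 / 4 * besselEntire (ν + 1) x) x := by
  have hν' : -1 < ν + 1 := by linarith
  let g' : ℕ → ℝ → ℝ := fun n y ↦ (n : ℝ) * (-y / 4) ^ (n - 1) * (-1 / 4) /
    ((n.factorial : ℝ) * Real.Gamma ((n : ℝ) + ν + 1))
  have hs : ∀ n y, g' (n + 1) y = -1 / 4 *
      ((-y / 4) ^ n / ((n.factorial : ℝ) * Real.Gamma ((n : ℝ) + (ν + 1) + 1))) :=
    fun n y ↦ deriv_term_succ ν y n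
  have hsum : ∀ y, Summable fun n ↦ ‖g' n y‖ := fun y ↦ by
    rw [← _root_.summable_nat_add_iff 1]
    simp only [hs, norm_mul]
    exact (summable_norm hν' y).mul_left _
  have hval : ∑' n, g' n x = -1 / 4 * besselEntire (ν + 1) x := by
    rw [(hsum x).of_norm.tsum_eq_zero_add]
    simp only [hs, tsum_mul_left, besselEntire]
    simp [g']
  rw [← hval]
  refine hasDerivAt_tsum_of_isPreconnected (hsum (|x| + 1)) Metric.isOpen_ball
    (convex_ball (0 : ℝ) (|x| + 1)).isPreconnected (fun n y _ ↦ ?_) (fun n y hy ↦ ?_)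
    (Metric.mem_ball_self (by positivity)) (summable hν 0) (by simp)
  · have : HasDerivAt (fun y : ℝ ↦ -y / 4) (-1 / 4) y := ((hasDerivAt_id y).neg).div_const 4
    exact (this.pow n).div_const _
  · have hy' : |y| ≤ |x| + 1 := by simpa using (mem_ball_zero_iff.1 hy).le
    simp only [g', norm_div, norm_mul, norm_pow, norm_neg, Real.norm_eq_abs]
    rw [abs_of_nonneg (by positivity : 0 ≤ |x| + 1)]
    gcongr

lemma differentiable (hν : -1 < ν) : Differentiable ℝ (besselEntire ν) :=
  fun x ↦ (hasDerivAt hν x).differentiableAt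

lemma contDiff (hν : -1 < ν) : ContDiff ℝ ∞ (besselEntire ν) := by
  rw [contDiff_infty]
  intro n
  induction n generalizing ν with
  | zero => exact contDiff_zero.2 (differentiable hν).continuous
  | succ n ih =>
    push_cast
    rw [contDiff_succ_iff_deriv]
    refine ⟨differentiable hν, by simp, ?_⟩
    rw [show deriv (besselEntire ν) = fun x ↦ -1 / 4 * besselEntire (ν + 1) x from
      funext fun x ↦ (hasDerivAt hν x).deriv]
    exact contDiff_const.mul (ih (by linarith))

lemma apply_zero (ν : ℝ) : besselEntire ν 0 = 1 / Real.Gamma (ν + 1) := by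
  rw [besselEntire, tsum_eq_single 0 (fun n hn ↦ by simp [hn])]
  simp

lemma apply_zero_pos (hν : -1 < ν) : 0 < besselEntire ν 0 := by
  rw [apply_zero]
  exact one_div_pos.2 (Real.Gamma_pos_of_pos (by linarith))

/-- The three-term recurrence `J_ν = (2(ν+1)/x) J_{ν+1} - J_{ν+2}`. -/
lemma recurrence (hν : -1 < ν) (x : ℝ) :
    besselEntire ν x = (ν + 1) * besselEntire (ν + 1) x - x / 4 * besselEntire (ν + 1 + 1) x := by
  have hν1 : -1 < ν + 1 := by linarith
  have hν2 : -1 < ν + 1 + 1 := by linarith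
  have h := hasDerivAt hν1 x
  have hterm : ∀ n : ℕ, (-x / 4) ^ n / ((n.factorial : ℝ) * Real.Gamma ((n : ℝ) + ν + 1)) =
      (ν + 1) * ((-x / 4) ^ n / ((n.factorial : ℝ) * Real.Gamma ((n : ℝ) + (ν + 1) + 1))) +
      n * ((-x / 4) ^ n / ((n.factorial : ℝ) * Real.Gamma ((n : ℝ) + (ν + 1) + 1))) := by
    intro n
    have h2 := (gamma_pos hν n).ne'
    have h3 : (n.factorial : ℝ) ≠ 0 := by exact_mod_cast n.factorial_ne_zero
    have h4 : (n : ℝ) + ν + 1 ≠ 0 := by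
      have : (0 : ℝ) ≤ n := n.cast_nonneg
      linarith
    rw [gamma_succ hν]
    field_simp
    ring
  have hs1 := (summable hν1 x).mul_left (ν + 1)
  have hs2 : Summable fun n : ℕ ↦
      (n : ℝ) * ((-x / 4) ^ n / ((n.factorial : ℝ) * Real.Gamma ((n : ℝ) + (ν + 1) + 1))) := by
    have := (summable hν x).sub hs1
    simpa only [hterm, add_sub_cancel_left] using this
  have hshift : ∀ n : ℕ, ((n + 1 : ℕ) : ℝ) * ((-x / 4) ^ (n + 1) / (((n + 1).factorial : ℝ) *
      Real.Gamma (((n + 1 : ℕ) : ℝ) + (ν + 1) + 1))) =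
      -x / 4 * ((-x / 4) ^ n / ((n.factorial : ℝ) * Real.Gamma ((n : ℝ) + (ν + 1 + 1) + 1))) := by
    intro n
    have := deriv_term_succ (ν + 1) x n
    rw [pow_succ]
    linear_combination x * this
  rw [besselEntire, tsum_congr hterm, hs1.tsum_add hs2, tsum_mul_left, hs2.tsum_eq_zero_add,
    tsum_congr hshift, tsum_mul_left]
  simp only [Nat.cast_zero, zero_mul, zero_add, besselEntire]
  ring

end besselEntire

lemma besselJ_eq (ν : ℝ) {x : ℝ} (hx : 0 < x) :
    besselJ ν x = (x / 2) ^ ν * besselEntire ν (x ^ 2) := by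
  rw [besselJ, besselEntire, ← tsum_mul_left]
  refine tsum_congr fun n ↦ ?_
  rw [Real.rpow_add hx, Real.rpow_add two_pos, Real.div_rpow hx.le two_pos.le, div_pow,
    neg_pow (x ^ 2), Real.rpow_mul hx.le, Real.rpow_mul two_pos.le,
    Real.rpow_natCast, Real.rpow_natCast]
  norm_num
  field_simp

/-- The entire function with `d_ν(x) = (x/2)^ν diniEntire ν (x²)`. -/
noncomputable def diniEntire (ν x : ℝ) : ℝ :=
  besselEntire ν x - x / 2 * besselEntire (ν + 1) x

lemma dini_eq (ν : ℝ) {x : ℝ} (hx : 0 < x) :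
    dini ν x = (x / 2) ^ ν * diniEntire ν (x ^ 2) := by
  rw [dini, besselJ_eq ν hx, besselJ_eq (ν + 1) hx, Real.rpow_add_one (by positivity), diniEntire]
  ring

lemma dini_zero_nonneg {ν : ℝ} (hν : -1 < ν) : 0 ≤ dini ν 0 := by
  rw [dini, zero_mul, sub_zero, besselJ]
  refine tsum_nonneg fun n ↦ ?_
  have h := besselEntire.gamma_pos hν n
  cases n with
  | zero => positivity
  | succ n =>
    rw [Real.zero_rpow (by push_cast; linarith [(n.cast_nonneg : (0 : ℝ) ≤ n)])]
    simp

/-- If `f` agrees on `(0, b)` with a function which is absolutely monotonic on `[0, b)`, and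
`f 0 ≥ 0`, then the iterated derivatives of `f` within `[0, b)` are nonnegative, even if `f` is
discontinuous at `0`. -/
lemma iteratedDerivWithin_Ico_nonneg {b : ℝ} {f F : ℝ → ℝ} (sF : SmoothOnIco b F)
    (hF : ∀ N, NonnegDerivsUpTo b N F) (hfF : EqOn f F (Ioo 0 b)) (h0 : 0 ≤ f 0) (m : ℕ) :
    ∀ x ∈ Ico 0 b, 0 ≤ iteratedDerivWithin m f (Ico 0 b) x := by
  have heq : ∀ m, EqOn (iteratedDerivWithin m f (Ico 0 b)) (iteratedDeriv m F) (Ioo 0 b) := by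
    intro m
    induction m with
    | zero => simpa using hfF
    | succ m ih =>
      intro x hx
      rw [iteratedDerivWithin_succ, iteratedDeriv_succ,
        derivWithin_of_mem_nhds (Ico_mem_nhds hx.1 hx.2)]
      exact (ih.eventuallyEq_of_mem (isOpen_Ioo.mem_nhds hx)).deriv_eq
  intro x hx
  rcases hx.1.eq_or_lt with rfl | hpos
  · cases m with
    | zero => simpa using h0
    | succ m =>
      rw [iteratedDerivWithin_succ]
      by_cases hd : DifferentiableWithinAt ℝ (iteratedDerivWithin m f (Ico 0 b)) (Ico 0 b) 0
      · have hD : ∀ y ∈ Ioo 0 b, HasDerivAt (iteratedDerivWithin m f (Ico 0 b))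
            (iteratedDeriv (m + 1) F y) y := by
          intro y hy
          rw [iteratedDeriv_succ]
          exact ((sF.iteratedDeriv m).differentiableAt
            (Ioo_subset_Ico_self hy)).hasDerivAt.congr_of_eventuallyEq
            ((heq m).eventuallyEq_of_mem (isOpen_Ioo.mem_nhds hy))
        have hmono : MonotoneOn (iteratedDerivWithin m f (Ico 0 b)) (Ico 0 b) := by
          apply monotoneOn_of_deriv_nonneg (convex_Ico 0 b)
          · intro y hy
            rcases hy.1.eq_or_lt with rfl | hy0
            · exact hd.continuousWithinAt
            · exact (hD y ⟨hy0, hy.2⟩).continuousAt.continuousWithinAt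
          · rw [interior_Ico]
            exact fun y hy ↦ (hD y hy).differentiableAt.differentiableWithinAt
          · rw [interior_Ico]
            intro y hy
            rw [(hD y hy).deriv]
            exact hF (m + 1) (m + 1) le_rfl y (Ioo_subset_Ico_self hy)
        exact hmono.derivWithin_nonneg
      · rw [derivWithin_zero_of_not_differentiableWithinAt hd]
  · rw [heq m ⟨hpos, hx.2⟩]
    exact hF m m le_rfl x hx

lemma diniEntire_differentiable {ν : ℝ} (hν : -1 < ν) : Differentiable ℝ (diniEntire ν) :=
  (besselEntire.differentiable hν).sub
    ((differentiable_id.div_const 2).mul (besselEntire.differentiable (by linarith)))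

lemma diniEntire_contDiff {ν : ℝ} (hν : -1 < ν) : ContDiff ℝ ∞ (diniEntire ν) :=
  (besselEntire.contDiff hν).sub
    ((contDiff_id.div_const 2).mul (besselEntire.contDiff (by linarith)))

lemma diniEntire_pos {ν b : ℝ} (hν : -1 < ν) (hne : ∀ x ∈ Ioo 0 b, diniEntire ν x ≠ 0) :
    ∀ x ∈ Ico 0 b, 0 < diniEntire ν x := by
  have h0 : 0 < diniEntire ν 0 := by simpa [diniEntire] using besselEntire.apply_zero_pos hν
  intro x hx
  rcases hx.1.eq_or_lt with rfl | hpos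
  · exact h0
  by_contra! hneg
  obtain ⟨y, hy, hy0⟩ := intermediate_value_Icc' hpos.le
    (diniEntire_differentiable hν).continuous.continuousOn ⟨hneg, h0.le⟩
  rcases hy.1.eq_or_lt with rfl | hy1
  · exact h0.ne' hy0
  · exact hne y ⟨hy1, hy.2.trans_lt hx.2⟩ hy0

/-- `besselEntire ν` is positive as long as `diniEntire ν` is: the derivative of
`√x * besselEntire ν x` is `diniEntire ν x / (2 √x)`. -/
lemma besselEntire_pos {ν b : ℝ} (hν : -1 < ν) (hD : ∀ x ∈ Ico 0 b, 0 < diniEntire ν x) :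
    ∀ x ∈ Ico 0 b, 0 < besselEntire ν x := by
  have hmono : StrictMonoOn (fun x ↦ √x * besselEntire ν x) (Ico 0 b) := by
    apply strictMonoOn_of_deriv_pos (convex_Ico 0 b)
    · exact (Real.continuous_sqrt.mul (besselEntire.differentiable hν).continuous).continuousOn
    · rw [interior_Ico]
      intro x hx
      have hs : 0 < √x := Real.sqrt_pos.2 hx.1
      have h := (Real.hasDerivAt_sqrt hx.1.ne').fun_mul (besselEntire.hasDerivAt hν x)
      have hval : 1 / (2 * √x) * besselEntire ν x + √x * (-1 / 4 * besselEntire (ν + 1) x) =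
          diniEntire ν x / (2 * √x) := by
        rw [diniEntire]
        field_simp
        rw [Real.sq_sqrt hx.1.le]
        ring
      rw [h.deriv, hval]
      exact div_pos (hD x (Ioo_subset_Ico_self hx)) (by positivity)
  intro x hx
  rcases hx.1.eq_or_lt with rfl | hpos
  · exact besselEntire.apply_zero_pos hν
  · have h := hmono ⟨le_rfl, hpos.trans hx.2⟩ hx hpos
    simp only [Real.sqrt_zero, zero_mul] at h
    exact pos_of_mul_pos_right h (Real.sqrt_nonneg x)

/-- Minus the logarithmic derivative of `besselEntire ν`. -/
noncomputable def besselRatio (ν x : ℝ) : ℝ :=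
  besselEntire (ν + 1) x / (4 * besselEntire ν x)

lemma besselRatio_hasDerivAt_besselEntire {ν x : ℝ} (hν : -1 < ν) (hx : besselEntire ν x ≠ 0) :
    HasDerivAt (besselEntire ν) (-besselRatio ν x * besselEntire ν x) x := by
  convert! besselEntire.hasDerivAt hν x using 1
  rw [besselRatio]
  field_simp

lemma besselRatio_riccati {ν x : ℝ} (hν : -1 < ν) (hx : besselEntire ν x ≠ 0) :
    x * deriv (besselRatio ν) x + (ν + 1) * besselRatio ν x =
      1 / 4 + x * (besselRatio ν x * besselRatio ν x) := by
  have h := (besselEntire.hasDerivAt (ν := ν + 1) (by linarith) x).fun_div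
    ((besselEntire.hasDerivAt hν x).const_mul 4) (mul_ne_zero four_ne_zero hx)
  rw [show deriv (besselRatio ν) x = _ from h.deriv]
  have hrec := besselEntire.recurrence hν x
  simp only [besselRatio]
  field_simp
  linear_combination -4 * besselEntire ν x * hrec

lemma besselRatio_smooth {ν b : ℝ} (hν : -1 < ν) (hJ : ∀ x ∈ Ico 0 b, 0 < besselEntire ν x) :
    SmoothOnIco b (besselRatio ν) :=
  .div ((besselEntire.contDiff (by linarith)).smoothOnIco b)
    ((contDiff_const.mul (besselEntire.contDiff hν)).smoothOnIco b)
    fun x hx ↦ (mul_pos four_pos (hJ x hx)).ne'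

lemma besselEntire_eventually_ne {ν x : ℝ} (hν : -1 < ν) (hx : 0 < besselEntire ν x) :
    ∀ᶠ y in 𝓝 x, besselEntire ν y ≠ 0 :=
  (besselEntire.differentiable hν).continuous.continuousAt.eventually_ne hx.ne'

lemma besselRatio_nonnegDerivs {ν b : ℝ} (hν : -1 < ν)
    (hJ : ∀ x ∈ Ico 0 b, 0 < besselEntire ν x) (N : ℕ) :
    NonnegDerivsUpTo b N (besselRatio ν) := by
  refine nonnegDerivsUpTo_of_riccati (c := ν + 1) (r := 1 / 4) (J := besselEntire ν)
    (by linarith) (by norm_num) (besselRatio_smooth hν hJ)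
    (besselEntire.differentiable hν).continuous.continuousOn
    (fun x hx ↦ besselRatio_hasDerivAt_besselEntire hν (hJ x (Ioo_subset_Ico_self hx)).ne')
    (fun x hx ↦ hJ x (Ioo_subset_Ico_self hx)) (fun x hx ↦ ?_) N
  filter_upwards [besselEntire_eventually_ne hν (hJ x hx)] with y hy
  exact besselRatio_riccati hν hy

lemma diniEntire_eq {ν x : ℝ} (hx : besselEntire ν x ≠ 0) :
    diniEntire ν x = besselEntire ν x * (1 - 2 * (x * besselRatio ν x)) := by
  rw [diniEntire, besselRatio]
  field_simp
  ring

/-- The logarithmic derivative of `diniEntire ν` in terms of `besselRatio ν`. -/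
lemma diniEntire_hasDerivAt {ν x : ℝ} (hν : -1 < ν) (hx : besselEntire ν x ≠ 0)
    (hD : diniEntire ν x ≠ 0) :
    HasDerivAt (diniEntire ν) (-(besselRatio ν x + deriv (fun y ↦ 2 * (y * besselRatio ν y)) x *
      (1 / (1 - 2 * (x * besselRatio ν x)))) * diniEntire ν x) x := by
  have hne := (besselEntire.differentiable hν).continuous.continuousAt.eventually_ne hx
  have hw : DifferentiableAt ℝ (fun y ↦ 2 * (y * besselRatio ν y)) x := by
    have : DifferentiableAt ℝ (besselRatio ν) x :=
      (besselEntire.differentiable (by linarith) x).fun_div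
        ((besselEntire.differentiable hν x).const_mul 4) (mul_ne_zero four_ne_zero hx)
    fun_prop
  have h := ((besselRatio_hasDerivAt_besselEntire hν hx).fun_mul
    (hw.hasDerivAt.const_sub 1)).congr_of_eventuallyEq (hne.mono fun y hy ↦ diniEntire_eq hy)
  have h1 : 1 - 2 * (x * besselRatio ν x) ≠ 0 := by
    rw [diniEntire_eq hx] at hD
    exact right_ne_zero_of_mul hD
  convert! h using 1
  rw [diniEntire_eq hx]
  linear_combination -deriv (fun y ↦ 2 * (y * besselRatio ν y)) x * besselEntire ν x *
    one_div_mul_cancel h1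

lemma exp_div_diniEntire_nonnegDerivs {ν b : ℝ} (hν : -1 < ν)
    (hD : ∀ x ∈ Ico 0 b, 0 < diniEntire ν x) (N : ℕ) :
    NonnegDerivsUpTo b N (fun x ↦ Real.exp (-(3 * x) / (4 * (ν + 1))) / diniEntire ν x) := by
  have hν' : 0 < ν + 1 := by linarith
  have hJ := besselEntire_pos hν hD
  have su := besselRatio_smooth hν hJ
  have hu := besselRatio_nonnegDerivs hν hJ
  have sid : SmoothOnIco b (fun x ↦ x) := contDiff_id.smoothOnIco b
  have s2 : SmoothOnIco b (fun _ ↦ (2 : ℝ)) := contDiff_const.smoothOnIco b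
  have sw : SmoothOnIco b (fun x ↦ 2 * (x * besselRatio ν x)) := s2.mul (sid.mul su)
  have hw : ∀ N, NonnegDerivsUpTo b N (fun x ↦ 2 * (x * besselRatio ν x)) := fun N ↦
    (nonnegDerivsUpTo_const b N two_pos.le).mul ((nonnegDerivsUpTo_id b N).mul (hu N) sid su)
      s2 (sid.mul su)
  have hw1 : ∀ x ∈ Ico 0 b, 2 * (x * besselRatio ν x) < 1 := fun x hx ↦ by
    have h := hD x hx
    rw [diniEntire_eq (hJ x hx).ne'] at h
    exact sub_pos.1 (pos_of_mul_pos_right h (hJ x hx).le)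
  have s1 : SmoothOnIco b (fun _ ↦ (1 : ℝ)) := contDiff_const.smoothOnIco b
  have sv : SmoothOnIco b (fun x ↦ 1 / (1 - 2 * (x * besselRatio ν x))) :=
    s1.div (s1.sub sw) fun x hx ↦ (sub_pos.2 (hw1 x hx)).ne'
  let M : ℝ → ℝ := fun x ↦ besselRatio ν x + deriv (fun y ↦ 2 * (y * besselRatio ν y)) x *
      (1 / (1 - 2 * (x * besselRatio ν x)))
  have sM : SmoothOnIco b M := su.add (sw.deriv.mul sv)
  have hM : ∀ N, NonnegDerivsUpTo b N M := fun N ↦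
    (hu N).add ((hw (N + 1)).deriv.mul (nonnegDerivsUpTo_inv_one_sub sw hw1 hw N) sw.deriv sv)
      su (sw.deriv.mul sv)
  let c : ℝ := 3 / (4 * (ν + 1))
  have sL : SmoothOnIco b (fun x ↦ M x - c) := sM.sub (contDiff_const.smoothOnIco b)
  have hMc : ∀ x ∈ Ico 0 b, 0 ≤ M x - c := by
    intro x hx
    have h0 : (0 : ℝ) ∈ Ico 0 b := ⟨le_rfl, hx.1.trans_lt hx.2⟩
    have hM0 : M 0 = c := by
      have hd := ((hasDerivAt_id (0 : ℝ)).fun_mul (su.differentiableAt h0).hasDerivAt).const_mul 2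
      have hrec := besselEntire.recurrence hν 0
      have hne := (hJ 0 h0).ne'
      have hu0 : besselRatio ν 0 = 1 / (4 * (ν + 1)) := by
        have hne' : besselEntire (ν + 1) 0 ≠ 0 :=
          (besselEntire.apply_zero_pos (by linarith)).ne'
        rw [besselRatio, hrec]
        simp only [zero_div, zero_mul, sub_zero]
        field_simp
      simp only [M, c]
      rw [show deriv (fun y ↦ 2 * (y * besselRatio ν y)) 0 = _ from hd.deriv, hu0]
      simp only [id, zero_mul, mul_zero, sub_zero]
      ring
    have hmono : MonotoneOn M (Ico 0 b) :=
      monotoneOn_of_deriv_nonneg (convex_Ico 0 b) sM.continuousOn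
        (fun y hy ↦ (sM.differentiableAt (interior_subset hy)).differentiableWithinAt)
        (fun y hy ↦ by
          have := hM 1 1 le_rfl y (interior_subset hy)
          rwa [iteratedDeriv_one] at this)
    rw [← hM0]
    exact sub_nonneg.2 (hmono h0 hx hx.1)
  have hL : ∀ N, NonnegDerivsUpTo b N (fun x ↦ M x - c) := fun N ↦ by
    refine NonnegDerivsUpTo.mono (.of_deriv hMc ?_) (Nat.le_succ N)
    rw [show deriv (fun x ↦ M x - c) = deriv M from funext fun x ↦ deriv_sub_const c]
    exact (hM (N + 1)).deriv
  have hE : ContDiff ℝ ∞ (fun x : ℝ ↦ Real.exp (-(3 * x) / (4 * (ν + 1)))) := by fun_prop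
  refine nonnegDerivsUpTo_of_deriv_eq_mul
    (.div (hE.smoothOnIco b) ((diniEntire_contDiff hν).smoothOnIco b) fun x hx ↦ (hD x hx).ne')
    sL (fun x hx ↦ div_nonneg (Real.exp_nonneg _) (hD x hx).le) hL (fun x hx ↦ ?_) N
  have hDne : ∀ᶠ y in 𝓝 x, diniEntire ν y ≠ 0 :=
    (diniEntire_differentiable hν).continuous.continuousAt.eventually_ne (hD x hx).ne'
  filter_upwards [hDne, besselEntire_eventually_ne hν (hJ x hx)] with y hy hy'
  have he : HasDerivAt (fun x : ℝ ↦ Real.exp (-(3 * x) / (4 * (ν + 1))))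
      (Real.exp (-(3 * y) / (4 * (ν + 1))) * -c) y := by
    have : HasDerivAt (fun x : ℝ ↦ -(3 * x) / (4 * (ν + 1))) (-(3 * 1) / (4 * (ν + 1))) y :=
      (((hasDerivAt_id y).const_mul 3).neg).div_const _
    convert! this.exp using 1
    simp only [c]
    ring
  rw [(he.fun_div (diniEntire_hasDerivAt hν hy' hy) hy).deriv]
  simp only [M]
  field_simp
  ring

/-- Let `ν > -1` and let `a1 = α_{ν,1}` be the first positive zero of the
Dini function `d_ν`.  Then the function
`q_ν(x) = x^{ν/2} e^{-3x/(4(ν+1))} / d_ν(√x)`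
is absolutely monotonic on `[0, a1²)`: all of its derivatives (within `[0, a1²)`) are
nonnegative there. -/
theorem absolutely_monotonic_q (ν : ℝ) (hν : -1 < ν)
    (a1 : ℝ) (ha1pos : 0 < a1) (ha1zero : dini ν a1 = 0)
    (ha1min : ∀ y : ℝ, 0 < y → dini ν y = 0 → a1 ≤ y) :
    ∀ m : ℕ, ∀ x ∈ Set.Ico (0 : ℝ) (a1 ^ 2),
      0 ≤ iteratedDerivWithin m
        (fun s : ℝ => s ^ (ν / 2) * Real.exp (-(3 * s) / (4 * (ν + 1))) / dini ν (Real.sqrt s))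
        (Set.Ico (0 : ℝ) (a1 ^ 2)) x := by
  have hdini : ∀ x : ℝ, 0 < x → dini ν √x = x ^ (ν / 2) / 2 ^ ν * diniEntire ν x := by
    intro x hx
    rw [dini_eq ν (Real.sqrt_pos.2 hx), Real.sq_sqrt hx.le,
      Real.div_rpow (Real.sqrt_nonneg x) two_pos.le, Real.sqrt_eq_rpow, ← Real.rpow_mul hx.le,
      one_div_mul_eq_div]
  have hD : ∀ x ∈ Ico 0 (a1 ^ 2), 0 < diniEntire ν x := by
    refine diniEntire_pos hν fun x hx h ↦ ?_
    have := ha1min √x (Real.sqrt_pos.2 hx.1) (by rw [hdini x hx.1, h, mul_zero])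
    exact ((Real.sqrt_lt' ha1pos).2 hx.2).not_ge this
  have hE : ContDiff ℝ ∞ (fun x : ℝ ↦ Real.exp (-(3 * x) / (4 * (ν + 1)))) := by fun_prop
  have sQ : SmoothOnIco (a1 ^ 2)
      (fun x ↦ Real.exp (-(3 * x) / (4 * (ν + 1))) / diniEntire ν x) :=
    .div (hE.smoothOnIco _) ((diniEntire_contDiff hν).smoothOnIco _) fun x hx ↦ (hD x hx).ne'
  have s2 : SmoothOnIco (a1 ^ 2) (fun _ ↦ (2 : ℝ) ^ ν) := contDiff_const.smoothOnIco _
  refine iteratedDerivWithin_Ico_nonneg (s2.mul sQ)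
    (fun N ↦ (nonnegDerivsUpTo_const _ N (by positivity)).mul
      (exp_div_diniEntire_nonnegDerivs hν hD N) s2 sQ) (fun x hx ↦ ?_) ?_
  · have h1 : 0 < x ^ (ν / 2) := Real.rpow_pos_of_pos hx.1 _
    have h2 := (hD x (Ioo_subset_Ico_self hx)).ne'
    simp only [hdini x hx.1]
    field_simp
  · rw [Real.sqrt_zero]
    exact div_nonneg (by positivity) (dini_zero_nonneg hν)
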